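/- Let α, σ², ν, m, x_T > 0 and set ℓ = (α²/(2σ²ν))·(m² + 2·x_T·m). Define g(x) = x^(−2−ℓ) · exp( −(α²/(2σ²ν))·( x²/2 − (2m + x_T)·x + m²·x_T/x ) ) for x > 0. Then for every r ≥ 0 the integral ∫₀^∞ x^r g(x) dx is finite and positive. In particular, the normalized steady state of control strategy B is slim-tailed and all its moments are finite. -/

import Mathlib

open Real Set MeasureTheory

lemma aux_int (c b d s : ℝ) (hc : 0 < c) (hd : 0 < d) :
    IntegrableOn (fun x : ℝ => x ^ s * Real.exp (-c * (x ^ 2 / 2 - b * x + d / x)))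
      (Set.Ioi (0 : ℝ)) := by
  obtain ⟨n, hn⟩ := exists_nat_gt (-s)
  have hG := Real.GammaIntegral_convergent (s := s + n + 1) (by linarith)
  have hG2 := hG.const_mul ((n.factorial : ℝ) / (c * d) ^ n * Real.exp (c * (b + 1 / c) ^ 2 / 2))
  refine Integrable.mono' hG2 ?_ ?_
  · apply Measurable.aestronglyMeasurable
    fun_prop
  · refine (ae_restrict_mem measurableSet_Ioi).mono fun x hx => ?_
    have hx : 0 < x := hx
    rw [Real.norm_of_nonneg (by positivity)]
    have h1 : Real.exp (-(c * d / x)) ≤ (n.factorial : ℝ) / (c * d) ^ n * x ^ n := by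
      have h := Real.pow_div_factorial_le_exp (c * d / x) (by positivity) n
      rw [Real.exp_neg]
      have h2 := inv_anti₀ (by positivity) h
      refine h2.trans (le_of_eq ?_)
      rw [div_pow]
      field_simp
    have h2 : Real.exp (-c * (x ^ 2 / 2 - b * x)) ≤
        Real.exp (c * (b + 1 / c) ^ 2 / 2) * Real.exp (-x) := by
      rw [← Real.exp_add]
      apply Real.exp_le_exp.mpr
      have h3 : 0 ≤ c * (x - (b + 1 / c)) ^ 2 / 2 := by positivity
      have h4 : c * (x - (b + 1 / c)) ^ 2 / 2 =
          c * (b + 1 / c) ^ 2 / 2 + -x - (-c * (x ^ 2 / 2 - b * x)) := by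
        field_simp
        ring
      linarith
    have h5 : -c * (x ^ 2 / 2 - b * x + d / x) = -c * (x ^ 2 / 2 - b * x) + -(c * d / x) := by
      ring
    have h6 : x ^ (s + n + 1 - 1) = x ^ s * x ^ n := by
      rw [add_sub_cancel_right, Real.rpow_add hx, Real.rpow_natCast]
    rw [h5, Real.exp_add, h6]
    calc x ^ s * (Real.exp (-c * (x ^ 2 / 2 - b * x)) * Real.exp (-(c * d / x)))
        ≤ x ^ s * ((Real.exp (c * (b + 1 / c) ^ 2 / 2) * Real.exp (-x)) *
          ((n.factorial : ℝ) / (c * d) ^ n * x ^ n)) := by gcongr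
      _ = _ := by ring

theorem stmt_12 (α σ2 ν m xT ell : ℝ) (hα : 0 < α) (hσ : 0 < σ2) (hν : 0 < ν)
    (hm : 0 < m) (hxT : 0 < xT)
    (hell : ell = α ^ 2 / (2 * σ2 * ν) * (m ^ 2 + 2 * xT * m))
    (g : ℝ → ℝ)
    (hg : ∀ x, g x = x ^ (-2 - ell) *
      Real.exp (-(α ^ 2 / (2 * σ2 * ν)) *
        (x ^ 2 / 2 - (2 * m + xT) * x + m ^ 2 * xT / x))) :
    ∀ r : ℝ, 0 ≤ r →
      IntegrableOn (fun x => x ^ r * g x) (Set.Ioi (0 : ℝ)) ∧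
      0 < ∫ x in Set.Ioi (0 : ℝ), x ^ r * g x := by
  intro r _
  have hI : IntegrableOn (fun x => x ^ r * g x) (Set.Ioi (0 : ℝ)) := by
    refine (aux_int (α ^ 2 / (2 * σ2 * ν)) (2 * m + xT) (m ^ 2 * xT) (r + (-2 - ell))
      (by positivity) (by positivity)).congr_fun (fun x hx => ?_) measurableSet_Ioi
    have hx : 0 < x := hx
    simp only [hg]
    rw [Real.rpow_add hx, mul_assoc]
  have hpos : ∀ x ∈ Set.Ioi (0 : ℝ), 0 < x ^ r * g x := by
    intro x hx
    have hx : 0 < x := hx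
    rw [hg]
    positivity
  refine ⟨hI, ?_⟩
  rw [setIntegral_pos_iff_support_of_nonneg_ae
    ((ae_restrict_mem measurableSet_Ioi).mono fun x hx => (hpos x hx).le) hI]
  have : Function.support (fun x => x ^ r * g x) ∩ Set.Ioi (0 : ℝ) = Set.Ioi 0 :=
    Set.inter_eq_right.mpr fun x hx => (hpos x hx).ne'
  rw [this]
  simp
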